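/- arXiv:1102.2593 — 2 statements merged into one kernel-verified Lean document; each statement's English description precedes it below -/
import Mathlib

section
/- Let q be a prime power, let n, k, δ be integers with 1 < k ≤ n−k and 1 ≤ δ ≤ k, let 𝒞 be a [k×(n−k), (n−k)(k−δ+1), δ]_q MRD code, and let C^MRD be its lifted code. Then for each integer i with 0 ≤ i ≤ k−δ−1, each (k−δ−i)-dimensional subspace of 𝔽_q^n all of whose nonzero vectors belong to L^{(n,k)} is contained in exactly q^{(n−k)(i+1)} codewords of C^MRD. -/
open Module Polynomial Matrix

variable (F : Type) [Field F] [Fintype F]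

/-- `C` is a `[k × (n-k), (n-k)(k-δ+1), δ]_q` MRD (maximum rank distance) code:
an `F`-linear subspace of `k × (n-k)` matrices of dimension `(n-k)(k-δ+1)` in which
every nonzero matrix has rank at least `δ`. -/
def IsMRD (n k δ : ℕ) (C : Submodule F (Matrix (Fin k) (Fin (n - k)) F)) : Prop :=
  Module.finrank F C = (n - k) * (k - δ + 1) ∧
    ∀ A : Matrix (Fin k) (Fin (n - k)) F, A ∈ C → A ≠ 0 → δ ≤ A.rank

/-- The matrix `[I_k | A]`. -/
def liftMatrix (n k : ℕ) (A : Matrix (Fin k) (Fin (n - k)) F) : Matrix (Fin k) (Fin n) F :=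
  Matrix.of fun i j =>
    if h : (j : ℕ) < k then (if (i : ℕ) = (j : ℕ) then 1 else 0)
    else A i ⟨(j : ℕ) - k, by have := j.isLt; omega⟩

/-- The lifting of the matrix `A`: the row space of `[I_k | A]`, a subspace of `F^n`. -/
def liftSubspace (n k : ℕ) (A : Matrix (Fin k) (Fin (n - k)) F) : Submodule F (Fin n → F) :=
  Submodule.span F (Set.range fun i => liftMatrix F n k A i)

/-- The lifted code of a rank-metric code `C`: the set of liftings of all codewords of `C`. -/
def liftedCode (n k : ℕ) (C : Submodule F (Matrix (Fin k) (Fin (n - k)) F)) :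
    Set (Submodule F (Fin n → F)) :=
  {X | ∃ A ∈ C, X = liftSubspace F n k A}

/-- The subspace distance `d_S(X,Y) = dim X + dim Y - 2 dim (X ⊓ Y)`. -/
noncomputable def subDist {n : ℕ} (X Y : Submodule F (Fin n → F)) : ℕ :=
  finrank F X + finrank F Y - 2 * finrank F (X ⊓ Y : Submodule F (Fin n → F))

/-- `L^{(n,k)}`: vectors of `F^n` whose first `k` coordinates are not all zero. -/
def Lset (n k : ℕ) : Set (Fin n → F) := {v | ∃ i : Fin n, (i : ℕ) < k ∧ v i ≠ 0}

/-- `V^n`: one-dimensional subspaces of `F^n` spanned by vectors of `L^{(n,k)}`. -/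
def Vset (n k : ℕ) : Set (Submodule F (Fin n → F)) :=
  {X | ∃ v ∈ Lset F n k, X = Submodule.span F {v}}

/-- Projection of a vector of `F^n` onto its first `k` coordinates. -/
def projK (n k : ℕ) (v : Fin n → F) : Fin k → F :=
  fun i => if h : (i : ℕ) < n then v ⟨(i : ℕ), h⟩ else 0

/-- `V_A^{(n,k)}`: one-dimensional subspaces of `F^n` spanned by vectors whose projection
onto the first `k` coordinates is a nonzero vector spanning `A`. -/
def VA (n k : ℕ) (A : Submodule F (Fin k → F)) : Set (Submodule F (Fin n → F)) :=
  {X | ∃ v : Fin n → F, projK F n k v ≠ 0 ∧ Submodule.span F {projK F n k v} = A ∧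
    X = Submodule.span F {v}}

/-- `A_q(n,d,k)`: the maximum size of an `(n, M, d, k)_q` constant dimension code, i.e. of a
set of `k`-dimensional subspaces of `F^n` whose pairwise subspace distances are at least `d`. -/
noncomputable def Aq (n d k : ℕ) : ℕ :=
  sSup {M | ∃ S : Set (Submodule F (Fin n → F)), S.Finite ∧ S.ncard = M ∧
    (∀ X ∈ S, finrank F X = k) ∧ ∀ X ∈ S, ∀ Y ∈ S, X ≠ Y → d ≤ subDist F X Y}

/-- The Gaussian coefficient `[n, k]_q`: the number of `k`-dimensional subspaces of `F^n`. -/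
noncomputable def gaussNat (n k : ℕ) : ℕ :=
  Nat.card {X : Submodule F (Fin n → F) // finrank F X = k}

theorem Submodule.exists_le_finrank_eq {K V : Type*} [Field K] [AddCommGroup V] [Module K V]
    [FiniteDimensional K V] (W : Submodule K V) {d : ℕ} (hW : finrank K W ≤ d)
    (hd : d ≤ finrank K V) : ∃ W' : Submodule K V, W ≤ W' ∧ finrank K W' = d := by
  induction d, hW using Nat.le_induction with
  | base => exact ⟨W, le_rfl, rfl⟩
  | succ d _ ih =>
    obtain ⟨U, hWU, hU⟩ := ih (by omega)
    have hne : U ≠ ⊤ := by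
      rintro rfl
      rw [finrank_top] at hU
      omega
    obtain ⟨v, -, hv⟩ := SetLike.exists_of_lt hne.lt_top
    exact ⟨U ⊔ K ∙ v, hWU.trans le_sup_left, by
      rw [Submodule.finrank_sup_span_singleton hv, hU]⟩

/-- The linear map sending a matrix `A` to `v ↦ e v ᵥ* A`. -/
def vecMulComp {K V m p : Type*} [Field K] [AddCommGroup V] [Module K V] [Fintype m]
    (e : V →ₗ[K] m → K) : Matrix m p K →ₗ[K] V →ₗ[K] p → K where
  toFun A := A.vecMulLinear ∘ₗ e
  map_add' A B := by
    ext1 v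
    exact Matrix.vecMul_add A B (e v)
  map_smul' c A := by
    ext1 v
    exact Matrix.vecMul_smul (e v) c A

@[simp]
theorem vecMulComp_apply {K V m p : Type*} [Field K] [AddCommGroup V] [Module K V] [Fintype m]
    (e : V →ₗ[K] m → K) (A : Matrix m p K) (v : V) : vecMulComp e A v = e v ᵥ* A := rfl

theorem Matrix.rank_add_finrank_le_of_vecMul_eq_zero {K m p : Type*} [Field K] [Fintype m]
    [Fintype p] {A : Matrix m p K} {U : Submodule K (m → K)} (h : ∀ u ∈ U, u ᵥ* A = 0) :
    A.rank + finrank K U ≤ Fintype.card m := by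
  have hU : U ≤ LinearMap.ker Aᵀ.mulVecLin := fun u hu => by
    simpa [Matrix.mulVec_transpose] using h u hu
  have hker := Submodule.finrank_mono hU
  have hrank := LinearMap.finrank_range_add_finrank_ker Aᵀ.mulVecLin
  rw [finrank_fintype_fun_eq_card] at hrank
  rw [← Matrix.rank_transpose, Matrix.rank]
  omega

theorem IsMRD.vecMulComp_surjective {F : Type} [Field F] {n k δ : ℕ} (hδ1 : 1 ≤ δ) (hδk : δ ≤ k)
    {C : Submodule F (Matrix (Fin k) (Fin (n - k)) F)} (hC : IsMRD F n k δ C)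
    {V : Type*} [AddCommGroup V] [Module F V] {e : V →ₗ[F] Fin k → F}
    (he : Function.Injective e) (hV : finrank F V ≤ k - δ + 1) :
    Function.Surjective (vecMulComp e ∘ₗ C.subtype) := by
  obtain ⟨U, hU, hUdim⟩ := (LinearMap.range e).exists_le_finrank_eq (d := k - δ + 1)
    (by rwa [LinearMap.finrank_range_of_inj he])
    (by rw [finrank_fintype_fun_eq_card, Fintype.card_fin]; omega)
  set Φ := vecMulComp U.subtype ∘ₗ C.subtype with hΦ
  have hinj : Function.Injective Φ := by
    rw [← LinearMap.ker_eq_bot, LinearMap.ker_eq_bot']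
    intro A hA
    by_contra hA0
    have hrank := hC.2 A A.2 (by simpa using hA0)
    have hle := Matrix.rank_add_finrank_le_of_vecMul_eq_zero (A := A.1) (U := U)
      fun u hu => LinearMap.congr_fun hA ⟨u, hu⟩
    rw [hUdim, Fintype.card_fin] at hle
    omega
  have hsurj : Function.Surjective Φ := by
    refine (LinearMap.injective_iff_surjective_of_finrank_eq_finrank ?_).1 hinj
    rw [hC.1, finrank_linearMap, hUdim, finrank_fintype_fun_eq_card, Fintype.card_fin, mul_comm]
  intro f
  obtain ⟨s, hs⟩ := e.exists_leftInverse_of_injective (LinearMap.ker_eq_bot.2 he)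
  obtain ⟨A, hA⟩ := hsurj ((f ∘ₗ s) ∘ₗ U.subtype)
  refine ⟨A, LinearMap.ext fun v => ?_⟩
  have h := LinearMap.congr_fun hA ⟨e v, hU ⟨v, rfl⟩⟩
  have hv : s (e v) = v := LinearMap.congr_fun hs v
  simpa [hΦ, hv] using h

/-- A vector `v` lies in the row space of `[I_k | A]` iff its last `n - k` coordinates are
the image under `A` of its first `k` coordinates. -/
theorem mem_liftSubspace {F : Type} [Field F] {n k : ℕ} (hkn : k ≤ n)
    {A : Matrix (Fin k) (Fin (n - k)) F} {v : Fin n → F} :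
    v ∈ liftSubspace F n k A ↔
      (fun j : Fin k => v (j.castLE hkn)) ᵥ* A =
        fun j : Fin (n - k) => v ⟨k + j, by omega⟩ := by
  have hhead (x : Fin k → F) (j : Fin n) (hj : (j : ℕ) < k) :
      (x ᵥ* liftMatrix F n k A) j = x ⟨j, hj⟩ := by
    rw [Matrix.vecMul, dotProduct, Finset.sum_eq_single ⟨j, hj⟩]
    · simp [liftMatrix, hj]
    · intro b _ hb
      simp [liftMatrix, hj, Fin.val_ne_iff.2 hb]
    · simp
  have htail (x : Fin k → F) (j : Fin n) (hj : ¬ (j : ℕ) < k) :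
      (x ᵥ* liftMatrix F n k A) j = (x ᵥ* A) ⟨j - k, by omega⟩ := by
    simp [Matrix.vecMul, dotProduct, liftMatrix, hj]
  have hrange : liftSubspace F n k A = LinearMap.range (liftMatrix F n k A).vecMulLinear :=
    (_root_.range_vecMulLinear _).symm
  rw [hrange, LinearMap.mem_range]
  constructor
  · rintro ⟨x, rfl⟩
    ext j
    have hx : (fun j : Fin k => (x ᵥ* liftMatrix F n k A) (j.castLE hkn)) = x :=
      funext fun j => hhead x _ j.is_lt
    simp only [Matrix.vecMulLinear_apply]
    rw [htail x _ (by simp), hx]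
    simp
  · intro h
    refine ⟨fun j => v (j.castLE hkn), ?_⟩
    ext j
    rw [Matrix.vecMulLinear_apply]
    by_cases hj : (j : ℕ) < k
    · rw [hhead _ j hj]
      rfl
    · rw [htail _ j hj, h]
      exact congrArg v (Fin.ext (Nat.add_sub_cancel' (not_lt.1 hj)))

theorem liftSubspace_injective {F : Type} [Field F] {n k : ℕ} (hkn : k ≤ n) :
    Function.Injective (liftSubspace F n k) := by
  intro A B hAB
  have key : ∀ i, liftMatrix F n k A i ∈ liftSubspace F n k B := fun i =>
    hAB ▸ Submodule.subset_span ⟨i, rfl⟩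
  ext i j
  have h := congr_fun ((mem_liftSubspace hkn).1 (key i)) j
  have hhead : (fun j : Fin k => liftMatrix F n k A i (j.castLE hkn)) = Pi.single i 1 := by
    ext j
    simp [liftMatrix, Pi.single_apply, Fin.ext_iff, eq_comm]
  rw [hhead, Matrix.single_one_vecMul] at h
  simpa [liftMatrix] using h.symm

theorem LinearMap.ncard_preimage_singleton {K V W : Type*} [Field K] [Finite K] [AddCommGroup V]
    [Module K V] [Module.Finite K V] [AddCommGroup W] [Module K W] (f : V →ₗ[K] W)
    (hf : Function.Surjective f) (w : W) :
    (f ⁻¹' {w}).ncard = Nat.card K ^ (finrank K V - finrank K W) := by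
  obtain ⟨v, rfl⟩ := hf w
  have hfib : f ⁻¹' {f v} = (v + ·) '' (LinearMap.ker f : Set V) := by
    ext x
    simp [sub_eq_zero, ← sub_eq_neg_add]
  have hrank := f.finrank_range_add_finrank_ker
  have : Module.Finite K (LinearMap.ker f) := FiniteDimensional.finiteDimensional_submodule _
  rw [LinearMap.range_eq_top.2 hf, finrank_top] at hrank
  rw [hfib, Set.ncard_image_of_injective _ (add_right_injective v), ← Nat.card_coe_set_eq,
    ← hrank, Nat.add_sub_cancel_left]
  exact Module.natCard_eq_pow_finrank

/-- For `0 ≤ i ≤ k-δ-1`, each `(k-δ-i)`-dimensional subspace of `F^n` all of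
whose nonzero vectors belong to `L^{(n,k)}` is contained in exactly `q^{(n-k)(i+1)}` codewords
of the lifted MRD code. -/
theorem stmt4 (q n k δ : ℕ) (hq : Fintype.card F = q)
    (hk : 1 < k) (hkn : k ≤ n - k) (hδ1 : 1 ≤ δ) (hδk : δ ≤ k)
    (C : Submodule F (Matrix (Fin k) (Fin (n - k)) F)) (hC : IsMRD F n k δ C)
    (i : ℕ) (hi : i + δ + 1 ≤ k) :
    ∀ Y : Submodule F (Fin n → F), finrank F Y = k - δ - i →
      (∀ v : Fin n → F, v ∈ Y → v ≠ 0 → v ∈ Lset F n k) →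
      {X ∈ liftedCode F n k C | Y ≤ X}.ncard = q ^ ((n - k) * (i + 1)) := by
  intro Y hY hYL
  have hkn' : k ≤ n := by omega
  let head : Y →ₗ[F] Fin k → F := LinearMap.funLeft F F (Fin.castLE hkn') ∘ₗ Y.subtype
  let tail : Y →ₗ[F] Fin (n - k) → F :=
    LinearMap.funLeft F F (fun j => ⟨k + j, by omega⟩) ∘ₗ Y.subtype
  have hinj : Function.Injective head := by
    rw [← LinearMap.ker_eq_bot, LinearMap.ker_eq_bot']
    intro v hv
    by_contra hv0
    obtain ⟨j, hj, hvj⟩ := hYL v v.2 (by simpa using hv0)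
    exact hvj (congr_fun hv ⟨j, hj⟩)
  have hle (A : Matrix (Fin k) (Fin (n - k)) F) :
      Y ≤ liftSubspace F n k A ↔ vecMulComp head A = tail :=
    ⟨fun h => LinearMap.ext fun v => (mem_liftSubspace hkn').1 (h v.2),
      fun h v hv => (mem_liftSubspace hkn').2 (LinearMap.congr_fun h ⟨v, hv⟩)⟩
  have hset : {X ∈ liftedCode F n k C | Y ≤ X} =
      (fun A : C => liftSubspace F n k A) '' ((vecMulComp head ∘ₗ C.subtype) ⁻¹' {tail}) := by
    ext X
    constructor
    · rintro ⟨⟨A, hA, rfl⟩, hX⟩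
      exact ⟨⟨A, hA⟩, (hle A).1 hX, rfl⟩
    · rintro ⟨A, hA, rfl⟩
      exact ⟨⟨A, A.2, rfl⟩, (hle A).2 hA⟩
  have hlift : Function.Injective fun A : C => liftSubspace F n k A :=
    (liftSubspace_injective hkn').comp Subtype.val_injective
  rw [hset, Set.ncard_image_of_injective _ hlift,
    LinearMap.ncard_preimage_singleton _
      (hC.vecMulComp_surjective hδ1 hδk hinj (by omega)),
    Nat.card_eq_fintype_card, hq, hC.1, finrank_linearMap, hY, finrank_fintype_fun_eq_card,
    Fintype.card_fin, mul_comm (k - δ - i), ← Nat.mul_sub]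
  congr 2
  omega
end

section
/- Let q be a prime power and let n ≥ 8 be an integer. Set s = n−4 if n is odd and s = n−3 if n is even, and suppose q² + q + 1 ≥ s. Then there exists an (n, M, 4, 3)_q constant dimension code with M = q^{2(n−3)} + Gauss[n−3, 2]_q which contains an (n,3,2)_q lifted MRD code; in particular A_q(n,4,3) ≥ q^{2(n−3)} + Gauss[n−3, 2]_q, and this attains the upper bound q^{2(n−3)} + A_q(n−3,2,2) for codes containing an (n,3,2)_q lifted MRD code. -/
open Module Polynomial Matrix

variable (F : Type) [Field F] [Fintype F]

section ConstantDimensionCodes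

variable {F}

theorem exists_extension_linearIndependent {N : ℕ} (hN : 3 ≤ N) :
    ∃ (K : Type) (_ : Field K) (_ : Algebra F K), finrank F K = N ∧
      ∃ α β : K, ∀ a b c : F, a • (1 : K) + b • α + c • β = 0 → a = 0 ∧ b = 0 ∧ c = 0 := by
  obtain ⟨p, hp⟩ := CharP.exists F
  have : Fact p.Prime := ⟨CharP.char_is_prime F p⟩
  have : NeZero N := ⟨by omega⟩
  let K := FiniteField.Extension F p N
  have hfin : finrank F K = N := by
    have h1 := FiniteField.natCard_extension F p N
    have h2 := Module.natCard_eq_pow_finrank (K := F) (V := K)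
    rw [h1] at h2
    exact (Nat.pow_right_injective (Finite.one_lt_card (α := F)) h2).symm
  obtain ⟨α, hα⟩ := Field.exists_primitive_element F K
  have hdeg := (Field.primitive_element_iff_minpoly_natDegree_eq F α).1 hα
  have hli := (linearIndependent_pow (K := F) α).comp
    (Fin.castLE (show 3 ≤ (minpoly F α).natDegree by omega)) (Fin.castLE_injective _)
  refine ⟨K, inferInstance, inferInstance, hfin, α, α ^ 2, fun a b c h => ?_⟩
  have := Fintype.linearIndependent_iff.1 hli ![a, b, c]
    (by simpa [Fin.sum_univ_three] using h)
  exact ⟨this 0, this 1, this 2⟩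

theorem exists_relations_le_span_of_linearIndependent {K : Type*} [Field K] [Algebra F K]
    {α β : K} (hli : ∀ a b c : F, a • (1 : K) + b • α + c • β = 0 → a = 0 ∧ b = 0 ∧ c = 0)
    {x y : K} (hxy : x ≠ 0 ∨ y ≠ 0) :
    ∃ c : Fin 3 → F, ∀ u : Fin 3 → F,
      u 0 • (α * x + β * y) + u 1 • x + u 2 • y = 0 → u ∈ Submodule.span F {c} := by
  by_cases hc : ∃ c : Fin 3 → F, c ≠ 0 ∧ c 0 = 0 ∧ c 1 • x + c 2 • y = 0
  · obtain ⟨c, hc, hc0, hcr⟩ := hc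
    refine ⟨c, fun u hu => ?_⟩
    rw [Submodule.mem_span_singleton]
    by_cases h1 : c 1 = 0
    · have h2 : c 2 ≠ 0 := by
        intro h2
        exact hc (by ext i; fin_cases i <;> assumption)
      have hy : y = 0 := by simpa [h1, h2] using hcr
      subst hy
      have hx : x ≠ 0 := by simpa using hxy
      have : (u 1 • (1 : K) + u 0 • α + (0 : F) • β) * x = 0 := by
        rw [← hu]
        simp only [Algebra.smul_def, map_zero]
        ring
      obtain ⟨e1, e0, -⟩ := hli _ _ _ ((mul_eq_zero.1 this).resolve_right hx)
      refine ⟨u 2 / c 2, ?_⟩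
      ext i
      fin_cases i
      · simp [hc0, e0]
      · simp [h1, e1]
      · simp [h2]
    · have hx : x = -((c 2 / c 1) • y) := by
        have : c 1 • x = - (c 2 • y) := eq_neg_of_add_eq_zero_left hcr
        rw [← inv_smul_smul₀ h1 x, this, smul_neg, smul_smul, div_eq_inv_mul]
      have hy : y ≠ 0 := by
        rintro rfl
        simp only [smul_zero, neg_zero] at hx
        simp [hx] at hxy
      have : ((u 2 - u 1 * (c 2 / c 1)) • (1 : K) + (-(u 0 * (c 2 / c 1))) • α + u 0 • β) * y
          = 0 := by
        rw [← hu, hx]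
        simp only [Algebra.smul_def, map_sub, map_neg, map_mul]
        ring
      obtain ⟨e2, -, e0⟩ := hli _ _ _ ((mul_eq_zero.1 this).resolve_right hy)
      refine ⟨u 1 / c 1, ?_⟩
      ext i
      fin_cases i
      · simp [hc0, e0]
      · simp [h1]
      · change u 1 / c 1 * c 2 = u 2
        rw [sub_eq_zero.1 e2]
        ring
  · have h0 : ∀ c : Fin 3 → F, c 0 = 0 → c 1 • x + c 2 • y = 0 → c = 0 := by
      intro c h h'
      by_contra hne
      exact hc ⟨c, hne, h, h'⟩
    by_cases hex : ∃ c : Fin 3 → F, c 0 ≠ 0 ∧ c 0 • (α * x + β * y) + c 1 • x + c 2 • y = 0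
    · obtain ⟨c, hc0, hcr⟩ := hex
      refine ⟨c, fun u hu => ?_⟩
      rw [Submodule.mem_span_singleton]
      refine ⟨u 0 / c 0, ?_⟩
      rw [eq_comm, ← sub_eq_zero]
      refine h0 _ (by simp [hc0]) ?_
      calc _ = (u 0 • (α * x + β * y) + u 1 • x + u 2 • y) - (u 0 / c 0) •
            (c 0 • (α * x + β * y) + c 1 • x + c 2 • y) := by
            simp only [smul_add, smul_smul, div_mul_cancel₀ _ hc0, Pi.sub_apply, Pi.smul_apply,
              sub_smul, smul_eq_mul]
            abel
        _ = 0 := by rw [hu, hcr, smul_zero, sub_zero]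
    · refine ⟨0, fun u hu => ?_⟩
      have hu0 : u 0 = 0 := by
        by_contra h
        exact hex ⟨u, h, hu⟩
      rw [h0 u hu0 (by simpa [hu0] using hu)]
      exact Submodule.zero_mem _

/-- On a space of dimension at least three there are `f`, `g` such that the triples
`(f x + g y, x, y)` with `(x, y) ≠ 0` satisfy at most one linear relation up to scalars. -/
theorem exists_endomorphisms_relations_le_span {V : Type*} [AddCommGroup V] [Module F V]
    [FiniteDimensional F V] (hV : 3 ≤ finrank F V) :
    ∃ f g : V →ₗ[F] V, ∀ x y : V, (x ≠ 0 ∨ y ≠ 0) → ∃ c : Fin 3 → F, ∀ u : Fin 3 → F,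
      u 0 • (f x + g y) + u 1 • x + u 2 • y = 0 → u ∈ Submodule.span F {c} := by
  obtain ⟨K, _, _, hK, α, β, hli⟩ := exists_extension_linearIndependent (F := F) hV
  have : FiniteDimensional F K := FiniteDimensional.of_finrank_pos (by omega)
  let e : V ≃ₗ[F] K := LinearEquiv.ofFinrankEq V K hK.symm
  refine ⟨e.symm.toLinearMap ∘ₗ LinearMap.mulLeft F α ∘ₗ e.toLinearMap,
    e.symm.toLinearMap ∘ₗ LinearMap.mulLeft F β ∘ₗ e.toLinearMap, fun x y hxy => ?_⟩
  obtain ⟨c, hc⟩ := exists_relations_le_span_of_linearIndependent hli (x := e x) (y := e y)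
    (by simpa using hxy)
  refine ⟨c, fun u hu => hc u ?_⟩
  simpa using congrArg e hu

theorem exists_endomorphisms_of_coordinates {m : ℕ} (hm : 5 ≤ m) (i j : Fin m) :
    ∃ f g : (Fin m → F) →ₗ[F] (Fin m → F),
      (∀ x, f x i = 0 ∧ f x j = 0) ∧ (∀ x, g x i = 0 ∧ g x j = 0) ∧
      ∀ x y : Fin m → F, x i = 0 → x j = 0 → y i = 0 → y j = 0 → (x ≠ 0 ∨ y ≠ 0) →
        ∃ c : Fin 3 → F, ∀ u : Fin 3 → F,
          u 0 • (f x + g y) + u 1 • x + u 2 • y = 0 → u ∈ Submodule.span F {c} := by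
  let L : (Fin m → F) →ₗ[F] F × F := (LinearMap.proj i).prod (LinearMap.proj j)
  let U := LinearMap.ker L
  have hmem : ∀ x : Fin m → F, x ∈ U ↔ x i = 0 ∧ x j = 0 := by
    intro x
    simp [U, L, LinearMap.mem_ker]
  have hU : 3 ≤ finrank F U := by
    have h1 := L.finrank_range_add_finrank_ker
    have h2 := (LinearMap.range L).finrank_le
    simp at h1 h2
    change _ + finrank F U = m at h1
    omega
  obtain ⟨f, g, hfg⟩ := exists_endomorphisms_relations_le_span hU
  obtain ⟨p, hp⟩ := U.subtype.exists_leftInverse_of_injective U.ker_subtype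
  refine ⟨U.subtype ∘ₗ f ∘ₗ p, U.subtype ∘ₗ g ∘ₗ p, fun x => (hmem _).1 (f (p x)).2,
    fun x => (hmem _).1 (g (p x)).2, fun x y hxi hxj hyi hyj hxy => ?_⟩
  lift x to U using (hmem x).2 ⟨hxi, hxj⟩
  lift y to U using (hmem y).2 ⟨hyi, hyj⟩
  obtain ⟨c, hc⟩ := hfg x y (by simpa using hxy)
  refine ⟨c, fun u hu => hc u ?_⟩
  have hpx : ∀ z : U, p z = z := fun z => LinearMap.congr_fun hp z
  simp only [LinearMap.comp_apply, hpx, Submodule.subtype_apply] at hu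
  exact Subtype.ext hu

/-- The (near-)one-factorization of the complete graph given by sums modulo an odd number `s`,
with an optional extra vertex `s`, is a proper edge colouring. -/
theorem edgeColor_injective {s i j i' j' : ℕ} (hs : s % 2 = 1) (hij : i < j) (hj : j ≤ s)
    (hij' : i' < j') (hj' : j' ≤ s) (hshare : i = i' ∨ i = j' ∨ j = i' ∨ j = j')
    (h : (if j = s then 2 * i else i + j) % s = (if j' = s then 2 * i' else i' + j') % s) :
    i = i' ∧ j = j' := by
  have hmod : ∀ a, a < 2 * s → a % s = if a < s then a else a - s := by
    intro a ha
    split_ifs with h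
    · exact Nat.mod_eq_of_lt h
    · rw [Nat.mod_eq_sub_mod (by omega), Nat.mod_eq_of_lt (by omega)]
  rw [hmod _ (by split_ifs <;> omega), hmod _ (by split_ifs <;> omega)] at h
  split_ifs at h <;> omega

theorem exists_pairwise_independent_vectors :
    ∃ a : ℕ → Fin 3 → F, (∀ c, a c ≠ 0) ∧ ∀ c d, c < Fintype.card F ^ 2 + Fintype.card F + 1 →
      d < Fintype.card F ^ 2 + Fintype.card F + 1 → c ≠ d →
      ∀ x y : F, x • a c = y • a d → x = 0 ∧ y = 0 := by
  classical
  have hcard : Nat.card (Projectivization F (Fin 3 → F)) =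
      Fintype.card F ^ 2 + Fintype.card F + 1 := by
    rw [Projectivization.card_of_finrank F (Fin 3 → F) (n := 3) (by simp)]
    simp [Finset.sum_range_succ]
    ring
  let e := (Finite.equivFinOfCardEq hcard).symm
  refine ⟨fun c => if h : c < _ then (e ⟨c, h⟩).rep else fun _ => 1, fun c => ?_, ?_⟩
  · dsimp only
    split_ifs
    · exact Projectivization.rep_nonzero _
    · intro h
      exact one_ne_zero (congrFun h 0)
  · intro c d hc hd hcd x y hxy
    simp only [hc, hd, dite_true] at hxy
    have hne : e ⟨c, hc⟩ ≠ e ⟨d, hd⟩ := fun h => hcd (by simpa using h)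
    have hli := Projectivization.linearIndependent_pair_iff_ne.2 hne
    have := LinearIndependent.pair_iff.1 hli x (-y) (by rw [hxy, neg_smul, add_neg_cancel])
    simpa using this

omit [Fintype F] in
theorem exists_leading_pair {m : ℕ} (P : Submodule F (Fin m → F)) (hP : finrank F P = 2) :
    ∃ i j : Fin m, i < j ∧ ∀ v ∈ P, v ≠ 0 →
      (v i ≠ 0 ∧ ∀ k < i, v k = 0) ∨ (v j ≠ 0 ∧ ∀ k < j, v k = 0) := by
  classical
  have lead : ∀ Q : Submodule F (Fin m → F), Q ≠ ⊥ →
      ∃ i, (∃ v ∈ Q, v i ≠ 0) ∧ ∀ k < i, ∀ v ∈ Q, v k = 0 := by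
    intro Q hQ
    obtain ⟨v, hv, hv0⟩ := Q.exists_mem_ne_zero_of_ne_bot hQ
    obtain ⟨k, hk⟩ := Function.ne_iff.1 hv0
    have hwf := WellFounded.has_min (r := ((· < ·) : Fin m → Fin m → Prop)) wellFounded_lt
      {i | ∃ v ∈ Q, v i ≠ 0} ⟨k, v, hv, hk⟩
    obtain ⟨i, hi, hmin⟩ := hwf
    refine ⟨i, hi, fun k hk v hv => ?_⟩
    by_contra h
    exact hmin k ⟨v, hv, h⟩ hk
  obtain ⟨i, ⟨v₁, hv₁, hv₁i⟩, hi⟩ := lead P (by rintro rfl; simp at hP)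
  let φ : P →ₗ[F] F := (LinearMap.proj i).comp P.subtype
  have hφ : LinearMap.range φ = ⊤ :=
    LinearMap.range_eq_top.2 (LinearMap.surjective (by
      intro h
      exact hv₁i (LinearMap.congr_fun h ⟨v₁, hv₁⟩)))
  have hker : finrank F (LinearMap.ker φ) = 1 := by
    have := φ.finrank_range_add_finrank_ker
    rw [hφ, hP] at this
    simp at this
    omega
  have : Module.Free F (LinearMap.ker φ) := Module.Free.of_divisionRing F (LinearMap.ker φ)
  obtain ⟨w, hw0, hw⟩ := (finrank_eq_one_iff' (K := F) (V := LinearMap.ker φ)).1 hker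
  have hwi : (w : P).1 i = 0 := w.2
  have hwne : (w : P).1 ≠ 0 := by simpa using hw0
  obtain ⟨j, ⟨v₂, hv₂, hv₂j⟩, hj⟩ := lead (Submodule.span F {(w : P).1}) (by simpa using hwne)
  have hspan : ∀ v ∈ Submodule.span F {(w : P).1}, v ∈ P ∧ v i = 0 := by
    intro v hv
    obtain ⟨c, rfl⟩ := Submodule.mem_span_singleton.1 hv
    exact ⟨P.smul_mem _ (w : P).2, by simp [hwi]⟩
  have hwj : (w : P).1 j ≠ 0 := by
    obtain ⟨c, rfl⟩ := Submodule.mem_span_singleton.1 hv₂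
    intro h
    simp [h] at hv₂j
  refine ⟨i, j, ?_, fun v hv hv0 => ?_⟩
  · by_contra h
    rcases (not_lt.1 h).eq_or_lt with h | h
    · exact hwj (h ▸ hwi)
    · exact hwj (hi j h _ (w : P).2)
  · by_cases hvi : v i = 0
    · right
      obtain ⟨c, hc⟩ := hw ⟨⟨v, hv⟩, hvi⟩
      have hc' : c • (w : P).1 = v := congrArg (fun z : LinearMap.ker φ => (z : P).1) hc
      have hc0 : c ≠ 0 := by
        rintro rfl
        exact hv0 (by simpa using hc'.symm)
      refine ⟨by rw [← hc']; simp [hc0, hwj], fun k hk => ?_⟩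
      exact hj k hk v (hc' ▸ Submodule.smul_mem _ _ (Submodule.mem_span_singleton_self _))
    · exact Or.inl ⟨hvi, fun k hk => hi k hk v hv⟩

omit [Fintype F] in
theorem exists_dual_vectors {m : ℕ} (P : Submodule F (Fin m → F)) (hP : finrank F P = 2)
    (i j : Fin m) (hinj : ∀ v ∈ P, v i = 0 → v j = 0 → v = 0) :
    ∃ b₁ ∈ P, ∃ b₂ ∈ P, b₁ i = 1 ∧ b₁ j = 0 ∧ b₂ i = 0 ∧ b₂ j = 1 := by
  let φ : P →ₗ[F] F × F :=
    ((LinearMap.proj i).prod (LinearMap.proj j)).comp P.subtype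
  have hφ : Function.Injective φ := by
    rw [injective_iff_map_eq_zero]
    intro v hv
    have hv' : v.1 i = 0 ∧ v.1 j = 0 := Prod.mk.inj hv
    exact Subtype.ext (hinj v v.2 hv'.1 hv'.2)
  have hsurj := (LinearMap.injective_iff_surjective_of_finrank_eq_finrank
    (by rw [hP]; simp)).1 hφ
  obtain ⟨b₁, h₁⟩ := hsurj (1, 0)
  obtain ⟨b₂, h₂⟩ := hsurj (0, 1)
  exact ⟨b₁, b₁.2, b₂, b₂.2, (Prod.mk.inj h₁).1, (Prod.mk.inj h₁).2,
    (Prod.mk.inj h₂).1, (Prod.mk.inj h₂).2⟩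

/-- Parametrization of the subspace spanned by `(a, w)`, `(0, b₁)` and `(0, b₂)`. -/
def pencilMap {m : ℕ} (a : Fin 3 → F) (w b₁ b₂ : Fin m → F) :
    (Fin 3 → F) →ₗ[F] (Fin 3 → F) × (Fin m → F) :=
  ((LinearMap.proj 0).smulRight a).prod (Fintype.linearCombination F ![w, b₁, b₂])

omit [Fintype F] in
theorem pencilMap_apply {m : ℕ} (a : Fin 3 → F) (w b₁ b₂ : Fin m → F) (u : Fin 3 → F) :
    pencilMap a w b₁ b₂ u = (u 0 • a, u 0 • w + u 1 • b₁ + u 2 • b₂) := by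
  simp [pencilMap, Fintype.linearCombination_apply, Fin.sum_univ_three]

omit [Fintype F] in
theorem finrank_le_one_of_forall_eq_smul {V : Type*} [AddCommGroup V] [Module F V]
    (X : Submodule F V) (L : V →ₗ[F] Fin 3 → F) (a : Fin 3 → F)
    (hinj : ∀ x ∈ X, L x = 0 → x = 0) (ha : ∀ x ∈ X, ∃ c : F, L x = c • a) :
    finrank F X ≤ 1 := by
  have hle : LinearMap.range (L.comp X.subtype) ≤ Submodule.span F {a} := by
    rintro _ ⟨x, rfl⟩
    obtain ⟨c, hc⟩ := ha x x.2
    exact Submodule.mem_span_singleton.2 ⟨c, hc.symm⟩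
  have hi : Function.Injective (L.comp X.subtype) := by
    rw [injective_iff_map_eq_zero]
    intro x hx
    exact Subtype.ext (hinj x x.2 hx)
  rw [← LinearMap.finrank_range_of_inj hi]
  exact (Submodule.finrank_mono hle).trans ((finrank_span_le_card _).trans (by simp))

omit [Fintype F] in
theorem finrank_inf_le_one_of_ne {V : Type*} [AddCommGroup V] [Module F V]
    [FiniteDimensional F V] {P Q : Submodule F V} (hP : finrank F P = 2) (hQ : finrank F Q = 2)
    (hne : P ≠ Q) : finrank F (P ⊓ Q : Submodule F V) ≤ 1 := by
  by_contra h
  have h1 : P ⊓ Q = P := Submodule.eq_of_le_of_finrank_le inf_le_left (by omega)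
  have h2 : P ⊓ Q = Q := Submodule.eq_of_le_of_finrank_le inf_le_right (by omega)
  exact hne (h1.symm.trans h2)

/-- Coordinates `i < j` with a basis `b₁, b₂` of `P` dual to them, such that every nonzero vector
of `P` has its leading coordinate at `i` or `j`. -/
structure IsLeadingBasis {m : ℕ} (P : Submodule F (Fin m → F)) (i j : Fin m)
    (b₁ b₂ : Fin m → F) : Prop where
  lt : i < j
  lead : ∀ v ∈ P, v ≠ 0 → (v i ≠ 0 ∧ ∀ k < i, v k = 0) ∨ (v j ≠ 0 ∧ ∀ k < j, v k = 0)
  fst_mem : b₁ ∈ P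
  snd_mem : b₂ ∈ P
  fst_i : b₁ i = 1
  fst_j : b₁ j = 0
  snd_i : b₂ i = 0
  snd_j : b₂ j = 1

omit [Fintype F] in
theorem exists_isLeadingBasis {m : ℕ} (P : Submodule F (Fin m → F)) (hP : finrank F P = 2) :
    ∃ i j b₁ b₂, IsLeadingBasis P i j b₁ b₂ := by
  obtain ⟨i, j, hij, h⟩ := exists_leading_pair P hP
  obtain ⟨b₁, h₁, b₂, h₂, h₃, h₄, h₅, h₆⟩ := exists_dual_vectors P hP i j (by
    intro v hv hi hj
    by_contra hne
    rcases h v hv hne with h | h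
    · exact h.1 hi
    · exact h.1 hj)
  exact ⟨i, j, b₁, b₂, hij, h, h₁, h₂, h₃, h₄, h₅, h₆⟩

namespace IsLeadingBasis

variable {m : ℕ} {P Q : Submodule F (Fin m → F)} {i j i' j' : Fin m} {b₁ b₂ : Fin m → F}

omit [Fintype F] in
theorem eq_combination (h : IsLeadingBasis P i j b₁ b₂) {v : Fin m → F} (hv : v ∈ P) :
    v = v i • b₁ + v j • b₂ := by
  rw [← sub_eq_zero]
  by_contra hne
  have hmem : v - (v i • b₁ + v j • b₂) ∈ P :=
    P.sub_mem hv (P.add_mem (P.smul_mem _ h.fst_mem) (P.smul_mem _ h.snd_mem))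
  rcases h.lead _ hmem hne with h' | h'
  · exact h'.1 (by simp [h.fst_i, h.snd_i])
  · exact h'.1 (by simp [h.fst_j, h.snd_j])

omit [Fintype F] in
theorem eq_of_same_basis (h : IsLeadingBasis P i j b₁ b₂) (h' : IsLeadingBasis Q i j b₁ b₂) :
    P = Q := by
  apply le_antisymm
  · intro v hv
    rw [h.eq_combination hv]
    exact Q.add_mem (Q.smul_mem _ h'.fst_mem) (Q.smul_mem _ h'.snd_mem)
  · intro v hv
    rw [h'.eq_combination hv]
    exact P.add_mem (P.smul_mem _ h.fst_mem) (P.smul_mem _ h.snd_mem)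

omit [Fintype F] in
theorem share_of_mem {b₁' b₂' : Fin m → F} (h : IsLeadingBasis P i j b₁ b₂)
    (h' : IsLeadingBasis Q i' j' b₁' b₂') {v : Fin m → F} (hP : v ∈ P) (hQ : v ∈ Q)
    (hv : v ≠ 0) : i = i' ∨ i = j' ∨ j = i' ∨ j = j' := by
  have huniq : ∀ a b : Fin m, (v a ≠ 0 ∧ ∀ k < a, v k = 0) → (v b ≠ 0 ∧ ∀ k < b, v k = 0) →
      a = b := by
    intro a b ha hb
    rcases lt_trichotomy a b with hab | hab | hab
    · exact absurd (hb.2 a hab) ha.1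
    · exact hab
    · exact absurd (ha.2 b hab) hb.1
  rcases h.lead v hP hv with h1 | h1 <;> rcases h'.lead v hQ hv with h2 | h2
  · exact Or.inl (huniq _ _ h1 h2)
  · exact Or.inr (Or.inl (huniq _ _ h1 h2))
  · exact Or.inr (Or.inr (Or.inl (huniq _ _ h1 h2)))
  · exact Or.inr (Or.inr (Or.inr (huniq _ _ h1 h2)))

omit [Fintype F] in
theorem pencilMap_injective (h : IsLeadingBasis P i j b₁ b₂) {a : Fin 3 → F} (ha : a ≠ 0)
    (w : Fin m → F) : Function.Injective (pencilMap a w b₁ b₂) := by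
  rw [injective_iff_map_eq_zero]
  intro u hu
  rw [pencilMap_apply, Prod.mk_eq_zero] at hu
  have h0 : u 0 = 0 := (smul_eq_zero.1 hu.1).resolve_right ha
  have h1 : u 1 = 0 := by simpa [h0, h.fst_i, h.snd_i] using congrFun hu.2 i
  have h2 : u 2 = 0 := by simpa [h0, h.fst_j, h.snd_j] using congrFun hu.2 j
  ext k
  fin_cases k <;> assumption

omit [Fintype F] in
theorem mem_of_pencilMap (h : IsLeadingBasis P i j b₁ b₂) {a : Fin 3 → F} (ha : a ≠ 0)
    {w : Fin m → F} {u : Fin 3 → F} (hu : u 0 • a = 0) :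
    (pencilMap a w b₁ b₂ u).2 ∈ P := by
  have h0 : u 0 = 0 := (smul_eq_zero.1 hu).resolve_right ha
  rw [pencilMap_apply, h0]
  simp only [zero_smul, zero_add]
  exact P.add_mem (P.smul_mem _ h.fst_mem) (P.smul_mem _ h.snd_mem)

end IsLeadingBasis

theorem exists_pencil_family {m s : ℕ} (hm : 5 ≤ m) (hs : s % 2 = 1) (hms : m ≤ s + 1)
    (hsq : s ≤ Fintype.card F ^ 2 + Fintype.card F + 1) :
    ∃ X : {P : Submodule F (Fin m → F) // finrank F P = 2} →
        Submodule F ((Fin 3 → F) × (Fin m → F)),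
      (∀ P, finrank F (X P) = 3) ∧
      (∀ P, ∃ a : Fin 3 → F, ∀ x ∈ X P, ∃ c : F, x.1 = c • a) ∧
      ∀ P Q, P ≠ Q →
        finrank F (X P ⊓ X Q : Submodule F ((Fin 3 → F) × (Fin m → F))) ≤ 1 := by
  classical
  obtain ⟨a, ha0, ha⟩ := exists_pairwise_independent_vectors (F := F)
  choose f g hf hg hfg using exists_endomorphisms_of_coordinates (F := F) hm
  choose I J b₁ b₂ hb using
    fun P : {P : Submodule F (Fin m → F) // finrank F P = 2} => exists_isLeadingBasis P.1 P.2
  let col : {P : Submodule F (Fin m → F) // finrank F P = 2} → ℕ := fun P =>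
    (if (J P : ℕ) = s then 2 * (I P : ℕ) else (I P : ℕ) + (J P : ℕ)) % s
  have hcol : ∀ P, col P < Fintype.card F ^ 2 + Fintype.card F + 1 := fun P =>
    (Nat.mod_lt _ (by omega)).trans_le hsq
  let w : {P : Submodule F (Fin m → F) // finrank F P = 2} → Fin m → F := fun P =>
    f (I P) (J P) (b₁ P) + g (I P) (J P) (b₂ P)
  have hwI : ∀ P, w P (I P) = 0 := fun P => by simp [w, (hf _ _ _).1, (hg _ _ _).1]
  have hwJ : ∀ P, w P (J P) = 0 := fun P => by simp [w, (hf _ _ _).2, (hg _ _ _).2]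
  have hmul : ∀ P, ∀ x ∈ LinearMap.range (pencilMap (a (col P)) (w P) (b₁ P) (b₂ P)),
      ∃ c : F, x.1 = c • a (col P) := by
    rintro P _ ⟨u, rfl⟩
    exact ⟨u 0, by rw [pencilMap_apply]⟩
  have hmemP : ∀ P, ∀ x ∈ LinearMap.range (pencilMap (a (col P)) (w P) (b₁ P) (b₂ P)),
      x.1 = 0 → x.2 ∈ P.1 := by
    rintro P _ ⟨u, rfl⟩ hu
    exact ((hb P).mem_of_pencilMap (ha0 _) (by simpa [pencilMap_apply] using hu))
  refine ⟨fun P => LinearMap.range (pencilMap (a (col P)) (w P) (b₁ P) (b₂ P)), fun P => ?_,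
    fun P => ⟨_, hmul P⟩, fun P Q hPQ => ?_⟩
  · rw [LinearMap.finrank_range_of_inj ((hb P).pencilMap_injective (ha0 _) _)]
    simp
  have hPQ' : P.1 ≠ Q.1 := fun h => hPQ (Subtype.ext h)
  by_cases hc : col P = col Q
  · by_cases hbot : ∀ v ∈ P.1, v ∈ Q.1 → v = 0
    · refine finrank_le_one_of_forall_eq_smul _ (LinearMap.fst F _ _) (a (col P)) ?_
        fun x hx => hmul P x hx.1
      intro x hx hx0
      exact Prod.ext hx0 (hbot _ (hmemP P x hx.1 hx0) (hmemP Q x hx.2 hx0))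
    · push Not at hbot
      obtain ⟨v, hvP, hvQ, hv⟩ := hbot
      have hshare := (hb P).share_of_mem (hb Q) hvP hvQ hv
      obtain ⟨hI, hJ⟩ := edgeColor_injective hs (hb P).lt (by omega) (hb Q).lt (by omega)
        (by simpa only [Fin.ext_iff] using hshare) hc
      replace hI : I Q = I P := (Fin.ext hI).symm
      replace hJ : J Q = J P := (Fin.ext hJ).symm
      have hQ := hb Q
      have hQI := hwI Q
      have hQJ := hwJ Q
      rw [hI, hJ] at hQ
      rw [hI] at hQI
      rw [hJ] at hQJ
      have hdiff : b₁ P - b₁ Q ≠ 0 ∨ b₂ P - b₂ Q ≠ 0 := by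
        by_contra! h
        refine hPQ' ((hb P).eq_of_same_basis ?_)
        rwa [sub_eq_zero.1 h.1, sub_eq_zero.1 h.2]
      obtain ⟨c, hcspan⟩ := hfg (I P) (J P) (b₁ P - b₁ Q) (b₂ P - b₂ Q)
        (by simp [(hb P).fst_i, hQ.fst_i]) (by simp [(hb P).fst_j, hQ.fst_j])
        (by simp [(hb P).snd_i, hQ.snd_i]) (by simp [(hb P).snd_j, hQ.snd_j]) hdiff
      have hle : LinearMap.range (pencilMap (a (col P)) (w P) (b₁ P) (b₂ P)) ⊓
          LinearMap.range (pencilMap (a (col Q)) (w Q) (b₁ Q) (b₂ Q)) ≤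
          Submodule.span F {pencilMap (a (col P)) (w P) (b₁ P) (b₂ P) c} := by
        rintro x ⟨⟨u, rfl⟩, ⟨u', hu'⟩⟩
        have hEq := hu'
        rw [pencilMap_apply, pencilMap_apply, Prod.mk.injEq, ← hc] at hEq
        have h0 : u' 0 = u 0 := smul_left_injective F (ha0 _) hEq.1
        have h1 : u' 1 = u 1 := by
          simpa [hQI, hwI P, hQ.fst_i, hQ.snd_i, (hb P).fst_i, (hb P).snd_i]
            using congrFun hEq.2 (I P)
        have h2 : u' 2 = u 2 := by
          simpa [hQJ, hwJ P, hQ.fst_j, hQ.snd_j, (hb P).fst_j, (hb P).snd_j]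
            using congrFun hEq.2 (J P)
        have hmem := hcspan u (by
          have := hEq.2
          simp only [h0, h1, h2, w, hI, hJ] at this
          rw [map_sub, map_sub, ← sub_eq_zero.2 this.symm]
          module)
        obtain ⟨t, rfl⟩ := Submodule.mem_span_singleton.1 hmem
        rw [map_smul]
        exact Submodule.smul_mem _ _ (Submodule.mem_span_singleton_self _)
      exact (Submodule.finrank_mono hle).trans ((finrank_span_le_card _).trans (by simp))
  · have hfst : ∀ x ∈ LinearMap.range (pencilMap (a (col P)) (w P) (b₁ P) (b₂ P)) ⊓
        LinearMap.range (pencilMap (a (col Q)) (w Q) (b₁ Q) (b₂ Q)), x.1 = 0 := by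
      intro x hx
      obtain ⟨c, h1⟩ := hmul P x hx.1
      obtain ⟨d, h2⟩ := hmul Q x hx.2
      rw [h1, (ha _ _ (hcol P) (hcol Q) hc c d (h1.symm.trans h2)).1, zero_smul]
    refine le_trans ?_ (finrank_inf_le_one_of_ne P.2 Q.2 hPQ')
    let S := LinearMap.range (pencilMap (a (col P)) (w P) (b₁ P) (b₂ P)) ⊓
        LinearMap.range (pencilMap (a (col Q)) (w Q) (b₁ Q) (b₂ Q))
    have hinj : Function.Injective ((LinearMap.snd F (Fin 3 → F) (Fin m → F)).comp S.subtype) := by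
      rw [injective_iff_map_eq_zero]
      intro x hx
      exact Subtype.ext (Prod.ext (hfst x x.2) hx)
    change finrank F S ≤ _
    rw [← LinearMap.finrank_range_of_inj hinj]
    apply Submodule.finrank_mono
    rintro _ ⟨x, rfl⟩
    exact ⟨hmemP P x x.2.1 (hfst x x.2), hmemP Q x x.2.2 (hfst x x.2)⟩

omit [Fintype F] in
theorem rank_add_finrank_ker_vecMulLinear {k m : ℕ} (A : Matrix (Fin k) (Fin m) F) :
    A.rank + finrank F (LinearMap.ker A.vecMulLinear) = k := by
  have := A.vecMulLinear.finrank_range_add_finrank_ker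
  rwa [range_vecMulLinear, ← Matrix.rank_eq_finrank_span_row, Module.finrank_fin_fun]
    at this

theorem exists_rank_two_matrix_space {m : ℕ} (hm : 3 ≤ m) :
    ∃ C : Submodule F (Matrix (Fin 3) (Fin m) F), finrank F C = m * 2 ∧
      ∀ A ∈ C, A ≠ 0 → 2 ≤ A.rank := by
  obtain ⟨f, g, hfg⟩ := exists_endomorphisms_relations_le_span (F := F) (V := Fin m → F)
    (by simpa using hm)
  let T : (Fin m → F) × (Fin m → F) →ₗ[F] Matrix (Fin 3) (Fin m) F :=
    LinearMap.pi ![f.coprod g, LinearMap.fst F _ _, LinearMap.snd F _ _]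
  have hT : ∀ z, T z = ![f z.1 + g z.2, z.1, z.2] := by
    intro z
    ext i k
    fin_cases i <;> rfl
  have hinj : Function.Injective T := by
    intro z z' h
    rw [hT, hT] at h
    exact Prod.ext (congrFun h 1) (congrFun h 2)
  refine ⟨LinearMap.range T, ?_, ?_⟩
  · rw [LinearMap.finrank_range_of_inj hinj, Module.finrank_prod, Module.finrank_fin_fun]
    ring
  · rintro _ ⟨z, rfl⟩ hz
    have hz' : z.1 ≠ 0 ∨ z.2 ≠ 0 := by
      by_contra! h
      exact hz (by rw [Prod.ext (y := 0) h.1 h.2, map_zero])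
    obtain ⟨c, hc⟩ := hfg z.1 z.2 hz'
    have hker : LinearMap.ker (T z).vecMulLinear ≤ Submodule.span F {c} := by
      intro u hu
      refine hc u ?_
      rw [← LinearMap.mem_ker.1 hu, hT]
      ext k
      change _ = Matrix.vecMul u _ k
      simp [Matrix.vecMul, dotProduct, Fin.sum_univ_three, mul_add]
    have h1 := (Submodule.finrank_mono hker).trans (finrank_span_le_card _)
    rw [Set.toFinset_singleton, Finset.card_singleton] at h1
    have h2 := rank_add_finrank_ker_vecMulLinear (T z)
    omega

/-- The map `u ↦ (u, u A)`, whose range is the lifting of `A`. -/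
def graphMap {m : ℕ} (A : Matrix (Fin 3) (Fin m) F) :
    (Fin 3 → F) →ₗ[F] (Fin 3 → F) × (Fin m → F) :=
  LinearMap.id.prod A.vecMulLinear

omit [Fintype F] in
theorem finrank_range_graphMap {m : ℕ} (A : Matrix (Fin 3) (Fin m) F) :
    finrank F (LinearMap.range (graphMap A)) = 3 := by
  have : Function.Injective (graphMap A) := fun u v h => congrArg Prod.fst h
  rw [LinearMap.finrank_range_of_inj this, Module.finrank_fin_fun]

omit [Fintype F] in
theorem finrank_graph_inf_graph_le_one {m : ℕ} {A B : Matrix (Fin 3) (Fin m) F}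
    (h : 2 ≤ (A - B).rank) :
    finrank F (LinearMap.range (graphMap A) ⊓ LinearMap.range (graphMap B) :
      Submodule F ((Fin 3 → F) × (Fin m → F))) ≤ 1 := by
  have hle : LinearMap.range (graphMap A) ⊓ LinearMap.range (graphMap B) ≤
      (LinearMap.ker (A - B).vecMulLinear).map (graphMap A) := by
    rintro _ ⟨⟨u, rfl⟩, ⟨v, hv⟩⟩
    obtain rfl : v = u := congrArg Prod.fst hv
    refine ⟨v, ?_, rfl⟩
    have h2 : v ᵥ* B = v ᵥ* A := congrArg Prod.snd hv
    simp [h2]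
  have h1 := Submodule.finrank_mono hle
  have h2 := Submodule.finrank_map_le (graphMap A) (LinearMap.ker (A - B).vecMulLinear)
  have h3 := rank_add_finrank_ker_vecMulLinear (A - B)
  omega

omit [Fintype F] in
theorem finrank_graph_inf_le_one {m : ℕ} (A : Matrix (Fin 3) (Fin m) F)
    (X : Submodule F ((Fin 3 → F) × (Fin m → F))) {a : Fin 3 → F}
    (ha : ∀ x ∈ X, ∃ c : F, x.1 = c • a) :
    finrank F (LinearMap.range (graphMap A) ⊓ X :
      Submodule F ((Fin 3 → F) × (Fin m → F))) ≤ 1 := by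
  refine finrank_le_one_of_forall_eq_smul _ (LinearMap.fst F _ _) a ?_ fun x hx => ha x hx.2
  rintro _ ⟨⟨u, rfl⟩, -⟩ hu
  obtain rfl : u = 0 := hu
  exact map_zero _

/-- Concatenation of coordinate vectors. -/
def concatEquiv (n k : ℕ) (hk : k ≤ n) :
    ((Fin k → F) × (Fin (n - k) → F)) ≃ₗ[F] (Fin n → F) where
  toFun x j := if h : (j : ℕ) < k then x.1 ⟨j, h⟩ else x.2 ⟨(j : ℕ) - k, by omega⟩
  map_add' x y := by
    ext j
    by_cases h : (j : ℕ) < k <;> simp [h]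
  map_smul' c x := by
    ext j
    by_cases h : (j : ℕ) < k <;> simp [h]
  invFun v := (fun i => v ⟨i, by omega⟩, fun i => v ⟨(i : ℕ) + k, by omega⟩)
  left_inv x := by
    ext i <;> simp
  right_inv v := by
    ext j
    by_cases h : (j : ℕ) < k
    · simp [h]
    · simp [h, Nat.sub_add_cancel (not_lt.1 h)]

omit [Fintype F] in
theorem liftSubspace_eq_map (n : ℕ) (hn : 3 ≤ n) (A : Matrix (Fin 3) (Fin (n - 3)) F) :
    liftSubspace F n 3 A =
      (LinearMap.range (graphMap A)).map (concatEquiv (F := F) n 3 hn).toLinearMap := by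
  rw [LinearMap.range_eq_map, ← (Pi.basisFun F (Fin 3)).span_eq, Submodule.map_span,
    Submodule.map_span, ← Set.range_comp, ← Set.range_comp, liftSubspace]
  congr 2
  funext i
  ext j
  by_cases h : (j : ℕ) < 3
  · simp [liftMatrix, concatEquiv, graphMap, h, Pi.single_apply, Fin.ext_iff, eq_comm]
  · simp [liftMatrix, concatEquiv, graphMap, h]

theorem finite_submodule (n : ℕ) : Finite (Submodule F (Fin n → F)) :=
  Finite.of_injective (fun X => (X : Set (Fin n → F))) SetLike.coe_injective

theorem ncard_le_Aq {n d k : ℕ} (S : Set (Submodule F (Fin n → F)))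
    (hk : ∀ X ∈ S, finrank F X = k) (hd : ∀ X ∈ S, ∀ Y ∈ S, X ≠ Y → d ≤ subDist F X Y) :
    S.ncard ≤ Aq F n d k := by
  have := finite_submodule (F := F) n
  refine le_csSup ⟨Nat.card (Submodule F (Fin n → F)), ?_⟩ ⟨S, S.toFinite, rfl, hk, hd⟩
  rintro _ ⟨T, -, rfl, -⟩
  exact Set.ncard_le_card T

theorem gaussNat_two_eq_Aq (m : ℕ) : gaussNat F m 2 = Aq F m 2 2 := by
  have := finite_submodule (F := F) m
  have hcard : gaussNat F m 2 = {X : Submodule F (Fin m → F) | finrank F X = 2}.ncard := rfl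
  rw [hcard]
  apply le_antisymm
  · refine ncard_le_Aq _ (fun X hX => hX) fun X hX Y hY hne => ?_
    have := finrank_inf_le_one_of_ne hX hY hne
    simp only [Set.mem_ofPred_eq] at hX hY
    unfold subDist
    omega
  · refine csSup_le ⟨_, ∅, Set.finite_empty, rfl, by simp, by simp⟩ ?_
    rintro _ ⟨T, -, rfl, hT, -⟩
    exact Set.ncard_le_ncard hT (Set.toFinite _)

end ConstantDimensionCodes

/-- (Construction I.) Let `n ≥ 8`, `s = n-4` for odd `n` and `s = n-3` for
even `n`, and suppose `q² + q + 1 ≥ s`. Then there is an `(n, M, 4, 3)_q` constant dimension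
code with `M = q^{2(n-3)} + Gauss[n-3, 2]_q` containing an `(n,3,2)_q` lifted MRD code; in
particular `A_q(n,4,3) ≥ M`, and `M` attains the upper bound `q^{2(n-3)} + A_q(n-3,2,2)`. -/
theorem stmt12 (q n : ℕ) (hq : Fintype.card F = q) (hn : 8 ≤ n)
    (hs : (if n % 2 = 1 then n - 4 else n - 3) ≤ q ^ 2 + q + 1) :
    ∃ (C : Submodule F (Matrix (Fin 3) (Fin (n - 3)) F))
      (S : Set (Submodule F (Fin n → F))),
      IsMRD F n 3 2 C ∧ liftedCode F n 3 C ⊆ S ∧ S.Finite ∧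
      S.ncard = q ^ (2 * (n - 3)) + gaussNat F (n - 3) 2 ∧
      (∀ X ∈ S, finrank F X = 3) ∧
      (∀ X ∈ S, ∀ Y ∈ S, X ≠ Y → 4 ≤ subDist F X Y) ∧
      q ^ (2 * (n - 3)) + gaussNat F (n - 3) 2 ≤ Aq F n 4 3 ∧
      q ^ (2 * (n - 3)) + gaussNat F (n - 3) 2 = q ^ (2 * (n - 3)) + Aq F (n - 3) 2 2 := by
  have hm : 5 ≤ n - 3 := by omega
  obtain ⟨C, hCdim, hCrank⟩ := exists_rank_two_matrix_space (F := F) (m := n - 3) (by omega)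
  obtain ⟨X, hXdim, hXa, hXX⟩ := exists_pencil_family (F := F)
    (s := if n % 2 = 1 then n - 4 else n - 3) hm (by split_ifs <;> omega)
    (by split_ifs <;> omega) (by rw [hq]; exact hs)
  let Y : C ⊕ {P : Submodule F (Fin (n - 3) → F) // finrank F P = 2} →
      Submodule F ((Fin 3 → F) × (Fin (n - 3) → F)) :=
    Sum.elim (fun A => LinearMap.range (graphMap A.1)) X
  have hYdim : ∀ a, finrank F (Y a) = 3 := by
    rintro (A | P)
    · exact finrank_range_graphMap A.1
    · exact hXdim P
  have hYY : ∀ a b, a ≠ b →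
      finrank F (Y a ⊓ Y b : Submodule F ((Fin 3 → F) × (Fin (n - 3) → F))) ≤ 1 := by
    rintro (A | P) (B | Q) hab
    · refine finrank_graph_inf_graph_le_one (hCrank _ (C.sub_mem A.2 B.2) fun h => hab ?_)
      rw [Subtype.ext (sub_eq_zero.1 h)]
    · obtain ⟨a, ha⟩ := hXa Q
      exact finrank_graph_inf_le_one A.1 (X Q) ha
    · obtain ⟨a, ha⟩ := hXa P
      rw [inf_comm]
      exact finrank_graph_inf_le_one B.1 (X P) ha
    · exact hXX P Q fun h => hab (by rw [h])
  let e := concatEquiv (F := F) n 3 (by omega)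
  let Z := fun a => (Y a).map e.toLinearMap
  have hZdim : ∀ a, finrank F (Z a) = 3 := fun a =>
    (LinearEquiv.finrank_map_eq e (Y a)).trans (hYdim a)
  have hZZ : ∀ a b, a ≠ b → finrank F (Z a ⊓ Z b : Submodule F (Fin n → F)) ≤ 1 := by
    intro a b hab
    have h1 : Z a ⊓ Z b = (Y a ⊓ Y b).map e.toLinearMap :=
      (Submodule.map_inf _ e.injective).symm
    rw [h1]
    exact (LinearEquiv.finrank_map_eq e (Y a ⊓ Y b)).trans_le (hYY a b hab)
  have hZinj : Function.Injective Z := by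
    intro a b h
    by_contra hab
    have h1 := hZZ a b hab
    rw [← h, inf_idem, hZdim] at h1
    omega
  have := finite_submodule (F := F) n
  have := finite_submodule (F := F) (n - 3)
  have hdim : ∀ V ∈ Set.range Z, finrank F V = 3 := by
    rintro _ ⟨a, rfl⟩
    exact hZdim a
  have hdist : ∀ V ∈ Set.range Z, ∀ W ∈ Set.range Z, V ≠ W → 4 ≤ subDist F V W := by
    rintro _ ⟨a, rfl⟩ _ ⟨b, rfl⟩ hne
    have h1 := hZZ a b fun h => hne (by rw [h])
    unfold subDist
    rw [hZdim, hZdim]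
    omega
  have hcard : (Set.range Z).ncard = q ^ (2 * (n - 3)) + gaussNat F (n - 3) 2 := by
    have hC : Nat.card C = q ^ (2 * (n - 3)) := by
      rw [Module.natCard_eq_pow_finrank (K := F), hCdim, Nat.card_eq_fintype_card, hq, mul_comm]
    rw [← Nat.card_coe_set_eq, Nat.card_range_of_injective hZinj, Nat.card_sum, hC]
    rfl
  refine ⟨C, Set.range Z, ⟨hCdim, hCrank⟩, ?_, Set.toFinite _, hcard, hdim, hdist,
    hcard ▸ ncard_le_Aq _ hdim hdist, by rw [gaussNat_two_eq_Aq]⟩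
  rintro _ ⟨A, hA, rfl⟩
  exact ⟨Sum.inl ⟨A, hA⟩, (liftSubspace_eq_map n (by omega) A).symm⟩
end
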